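/- Let n be even and let C_k be a C-wave configuration of length n on H_n with interrupter set I ⊆ {v_{i,2} : i ∈ ℤ/n}. Then in the 1/2-power index process, C_{k+1} is a D-wave configuration of length n with interrupter set I′ = { v_{i,1} : exactly one of v_{i-1,2} and v_{i+1,2} is contained in I }. -/

import Mathlib

open scoped Classical

/-- A strategy of a voter: collaborator (`C`) or defector (`D`). -/
inductive Strategy : Type
  | C : Strategy
  | D : Strategy
deriving DecidableEq

noncomputable section

variable {V : Type*}

/-- The closed neighbourhood `N[v]` of a vertex, as a finset. -/
def closedNbhd (G : SimpleGraph V) [Fintype V] (v : V) : Finset V :=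
  Finset.univ.filter fun u => u = v ∨ G.Adj u v

/-- The (Shapley–Shubik style) power of a vertex `v` in configuration `c`
with win condition `w`. -/
def power (G : SimpleGraph V) [Fintype V] (w : ℝ) (c : V → Strategy) (v : V) : ℝ :=
  let N := closedNbhd G v
  let nC := (N.filter fun u => c u = Strategy.C).card
  let nD := (N.filter fun u => c u = Strategy.D).card
  match c v with
  | Strategy.C => if w < (nC : ℝ) / (N.card : ℝ) then 1 / (nC : ℝ) else 0
  | Strategy.D => if (nC : ℝ) / (N.card : ℝ) ≤ w then 1 / (nD : ℝ) else 0

/-- One step of the `w`-power index process: every vertex adopts the strategy of a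
vertex of maximum power in its closed neighbourhood, retaining its own strategy if
vertices of maximum power have differing strategies. -/
def step (G : SimpleGraph V) [Fintype V] (w : ℝ) (c : V → Strategy) (v : V) : Strategy :=
  let N := closedNbhd G v
  let M := N.filter fun u => ∀ x ∈ N, power G w c x ≤ power G w c u
  if ∀ u ∈ M, c u = Strategy.C then Strategy.C
  else if ∀ u ∈ M, c u = Strategy.D then Strategy.D
  else c v

/-- `configSeq G w c0 i` is the configuration `C_i` of the `w`-power index process. -/
def configSeq (G : SimpleGraph V) [Fintype V] (w : ℝ) (c0 : V → Strategy) : ℕ → V → Strategy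
  | 0 => c0
  | k + 1 => step G w (configSeq G w c0 k)

/-- The process is eventually stable. -/
def EventuallyStable (G : SimpleGraph V) [Fintype V] (w : ℝ) (c0 : V → Strategy) : Prop :=
  ∃ i, configSeq G w c0 (i + 1) = configSeq G w c0 i

/-- The process reaches a stable all-collaborator configuration. -/
def CollaboratorDominant (G : SimpleGraph V) [Fintype V] (w : ℝ) (c0 : V → Strategy) : Prop :=
  ∃ i, configSeq G w c0 (i + 1) = configSeq G w c0 i ∧
    ∀ v, configSeq G w c0 i v = Strategy.C

/-- The process reaches a stable all-defector configuration. -/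
def DefectorDominant (G : SimpleGraph V) [Fintype V] (w : ℝ) (c0 : V → Strategy) : Prop :=
  ∃ i, configSeq G w c0 (i + 1) = configSeq G w c0 i ∧
    ∀ v, configSeq G w c0 i v = Strategy.D

/-- The process is eventually periodic with period `ℓ`: `ℓ > 1` is the least integer
such that `C_i = C_{i+ℓ}` for some `i ≥ 0`. -/
def EventuallyPeriodicWithPeriod (G : SimpleGraph V) [Fintype V] (w : ℝ)
    (c0 : V → Strategy) (ℓ : ℕ) : Prop :=
  IsLeast {m : ℕ | 1 < m ∧ ∃ i, configSeq G w c0 (i + m) = configSeq G w c0 i} ℓ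

end

/-- Vertices of the graph `H_n`: a pair `(i, (j, t))` where `i ∈ ℤ/n` is the column,
`j ∈ {0, 1}` is the row (row `0` is row "1" of the paper, row `1` is row "2"),
and `t` records the kind of vertex: `t = 0` is `v_{i,j}` (a vertex of `C_n □ P_2`),
`t = 1` is `z_{i,j}` (the triangle vertex joined to `v_{i,j}`), and `t = 2, 3`
are `x_{i,j}, y_{i,j}` (the other two triangle vertices). -/
abbrev HVertex (n : ℕ) : Type := ZMod n × Fin 2 × Fin 4

/-- The graph `H_n`, obtained from `C_n □ P_2` by attaching, to each vertex
`v_{i,j}`, a pendant triangle `x_{i,j} y_{i,j} z_{i,j}` via the edge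
`v_{i,j} z_{i,j}`. -/
def Hgraph (n : ℕ) : SimpleGraph (HVertex n) :=
  SimpleGraph.fromRel fun a b =>
    -- cycle edges of each row: v_{i,j} ~ v_{i+1,j}
    (a.2.2 = 0 ∧ b.2.2 = 0 ∧ a.2.1 = b.2.1 ∧ b.1 = a.1 + 1) ∨
    -- rung edges: v_{i,0} ~ v_{i,1}
    (a.2.2 = 0 ∧ b.2.2 = 0 ∧ a.1 = b.1 ∧ a.2.1 ≠ b.2.1) ∨
    -- triangle edges among x, y, z at the same (i, j)
    (a.1 = b.1 ∧ a.2.1 = b.2.1 ∧ a.2.2 ≠ 0 ∧ b.2.2 ≠ 0) ∨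
    -- pendant edges: v_{i,j} ~ z_{i,j}
    (a.1 = b.1 ∧ a.2.1 = b.2.1 ∧ a.2.2 = 0 ∧ b.2.2 = 1)

/-- The configuration `W` on `H_n`: all vertices of row `0` (the paper's row `1`)
are collaborators, all vertices of row `1` (the paper's row `2`) are defectors. -/
def Wconfig (n : ℕ) : HVertex n → Strategy :=
  fun a => if a.2.1 = 0 then Strategy.C else Strategy.D

noncomputable section

/-- The `C`-wave configuration on `H_n` with interrupter columns `I`: the
configuration `W` with the strategies of the vertices `v_{i,2}` (`i ∈ I`) flipped
from `D` to `C`. -/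
def CwaveConfig (n : ℕ) (I : Set (ZMod n)) : HVertex n → Strategy :=
  fun a => if a.2.1 = 0 then Strategy.C
    else if a.2.2 = 0 ∧ a.1 ∈ I then Strategy.C else Strategy.D

/-- The `D`-wave configuration on `H_n` with interrupter columns `I`: the
configuration `W` with the strategies of the vertices `v_{i,1}` (`i ∈ I`) flipped
from `C` to `D`. -/
def DwaveConfig (n : ℕ) (I : Set (ZMod n)) : HVertex n → Strategy :=
  fun a => if a.2.1 = 0 then
    (if a.2.2 = 0 ∧ a.1 ∈ I then Strategy.D else Strategy.C) else Strategy.D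

/-- A set of interrupter columns is admissible for a wave configuration when all its
columns have the same parity. -/
def SameParity {n : ℕ} (I : Set (ZMod n)) : Prop :=
  ∃ p : ZMod 2, ∀ i ∈ I, ((i.val : ℕ) : ZMod 2) = p

end

theorem step_of {V : Type*} (G : SimpleGraph V) [Fintype V] (w : ℝ) (c : V → Strategy) (v : V)
    (s : Strategy) (u : V) (hu : u ∈ closedNbhd G v) (hs : c u = s)
    (h : ∀ x ∈ closedNbhd G v, power G w c x ≤ power G w c u ∧
      (c v ≠ s → c x ≠ s → power G w c x < power G w c u)) :
    step G w c v = s := by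
  have hM : u ∈ (closedNbhd G v).filter
      fun u => ∀ x ∈ closedNbhd G v, power G w c x ≤ power G w c u :=
    Finset.mem_filter.2 ⟨hu, fun x hx => (h x hx).1⟩
  have hall : c v ≠ s → ∀ x ∈ (closedNbhd G v).filter
      fun u => ∀ x ∈ closedNbhd G v, power G w c x ≤ power G w c u, c x = s := by
    intro hv x hx
    by_contra hne
    rw [Finset.mem_filter] at hx
    exact absurd (hx.2 u hu) (not_le.2 ((h x hx.1).2 hv hne))
  unfold step
  cases s with
  | C =>
    dsimp only
    split_ifs with h1 h2
    · rfl
    · have := h2 u hM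
      rw [hs] at this
      exact absurd this (by simp)
    · by_contra hv
      exact h1 (hall hv)
  | D =>
    dsimp only
    split_ifs with h1 h2
    · have := h1 u hM
      rw [hs] at this
      exact absurd this (by simp)
    · rfl
    · by_contra hv
      exact h2 (hall hv)

section
variable {n : ℕ} [NeZero n]

theorem nb_v (hn : 3 ≤ n) (i : ZMod n) (j : Fin 2) :
    closedNbhd (Hgraph n) (i, j, 0) =
      {(i, j, 0), (i + 1, j, 0), (i - 1, j, 0), (i, 1 - j, 0), (i, j, 1)} := by
  haveI : Fact (1 < n) := ⟨by omega⟩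
  ext ⟨a, b, t⟩
  simp only [closedNbhd, Hgraph, SimpleGraph.fromRel_adj, Finset.mem_filter, Finset.mem_univ,
    true_and, Finset.mem_insert, Finset.mem_singleton, Prod.mk.injEq, ne_eq]
  have e1 : i = a + 1 ↔ a = i - 1 := by
    rw [eq_sub_iff_add_eq]; exact eq_comm
  rw [e1, eq_comm (a := i) (b := a)]
  have h1 : i + 1 ≠ i := by simp
  have h2 : i - 1 ≠ i := by simp
  by_cases ha : a = i
  · subst ha
    fin_cases j <;> fin_cases b <;> fin_cases t <;> simp [h1.symm, h2.symm]
  · fin_cases j <;> fin_cases b <;> fin_cases t <;> simp [ha, or_comm]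

theorem nb_z (i : ZMod n) (j : Fin 2) :
    closedNbhd (Hgraph n) (i, j, 1) = {(i, j, 0), (i, j, 1), (i, j, 2), (i, j, 3)} := by
  ext ⟨a, b, t⟩
  simp only [closedNbhd, Hgraph, SimpleGraph.fromRel_adj, Finset.mem_filter, Finset.mem_univ,
    true_and, Finset.mem_insert, Finset.mem_singleton, Prod.mk.injEq, ne_eq,
    eq_comm (a := i) (b := a)]
  by_cases ha : a = i
  · subst ha
    fin_cases j <;> fin_cases b <;> fin_cases t <;> simp
  · simp [ha]

theorem nb_x (i : ZMod n) (j : Fin 2) (t : Fin 4) (ht : t = 2 ∨ t = 3) :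
    closedNbhd (Hgraph n) (i, j, t) = {(i, j, 1), (i, j, 2), (i, j, 3)} := by
  ext ⟨a, b, t'⟩
  simp only [closedNbhd, Hgraph, SimpleGraph.fromRel_adj, Finset.mem_filter, Finset.mem_univ,
    true_and, Finset.mem_insert, Finset.mem_singleton, Prod.mk.injEq, ne_eq,
    eq_comm (a := i) (b := a)]
  by_cases ha : a = i
  · subst ha
    rcases ht with rfl | rfl <;>
    fin_cases j <;> fin_cases b <;> fin_cases t' <;> simp
  · rcases ht with rfl | rfl <;> simp [ha]

theorem par (hev : Even n) (I : Set (ZMod n)) (hI : SameParity I) (i : ZMod n) (h : i ∈ I) :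
    i + 1 ∉ I := by
  intro h'
  obtain ⟨p, hp⟩ := hI
  have h1 := hp _ h
  have h2 := hp _ h'
  have hd : 2 ∣ n := hev.two_dvd
  rw [ZMod.natCast_val] at h1 h2
  rw [ZMod.cast_add hd, ZMod.cast_one hd, h1] at h2
  simp at h2

theorem par' (hev : Even n) (I : Set (ZMod n)) (hI : SameParity I) (i : ZMod n) (h : i ∈ I) :
    i - 1 ∉ I := by
  intro h'
  have := par hev I hI _ h'
  simp at this
  exact this h

variable (I : Set (ZMod n))

theorem c0 (i : ZMod n) (t : Fin 4) : CwaveConfig n I (i, 0, t) = .C := by simp [CwaveConfig]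
theorem c1 (i : ZMod n) (t : Fin 4) (ht : t ≠ 0) : CwaveConfig n I (i, 1, t) = .D := by
  simp [CwaveConfig, ht]
theorem c1I (i : ZMod n) (h : i ∈ I) : CwaveConfig n I (i, 1, 0) = .C := by
  simp [CwaveConfig, h]
theorem c1n (i : ZMod n) (h : i ∉ I) : CwaveConfig n I (i, 1, 0) = .D := by
  simp [CwaveConfig, h]

theorem f01 : (0 : Fin 4) ≠ 1 := by decide
theorem f02 : (0 : Fin 4) ≠ 2 := by decide
theorem f03 : (0 : Fin 4) ≠ 3 := by decide
theorem f12 : (1 : Fin 4) ≠ 2 := by decide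
theorem f13 : (1 : Fin 4) ≠ 3 := by decide
theorem f23 : (2 : Fin 4) ≠ 3 := by decide

theorem px0 (i : ZMod n) (t : Fin 4) (ht : t = 2 ∨ t = 3) :
    power (Hgraph n) (1/2) (CwaveConfig n I) (i, 0, t) = 1/3 := by
  simp only [power, nb_x i 0 t ht, c0, Finset.filter_insert, Finset.filter_singleton, reduceCtorEq, if_true, if_false]
  norm_num [Finset.card_insert_of_notMem, f01, f02, f03, f12, f13, f23]

theorem px1 (i : ZMod n) (t : Fin 4) (ht : t = 2 ∨ t = 3) :
    power (Hgraph n) (1/2) (CwaveConfig n I) (i, 1, t) = 1/3 := by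
  have : t ≠ 0 := by rcases ht with rfl | rfl <;> decide
  simp only [power, nb_x i 1 t ht, c1 I i t this, c1 I i 1 (by decide), c1 I i 2 (by decide), c1 I i 3 (by decide), Finset.filter_insert, Finset.filter_singleton, reduceCtorEq, if_true, if_false]
  norm_num [Finset.card_insert_of_notMem, f01, f02, f03, f12, f13, f23]

theorem pz0 (i : ZMod n) :
    power (Hgraph n) (1/2) (CwaveConfig n I) (i, 0, 1) = 1/4 := by
  simp only [power, nb_z i 0, c0, Finset.filter_insert, Finset.filter_singleton, reduceCtorEq, if_true, if_false]
  norm_num [Finset.card_insert_of_notMem, f01, f02, f03, f12, f13, f23]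

theorem pz1I (i : ZMod n) (h : i ∈ I) :
    power (Hgraph n) (1/2) (CwaveConfig n I) (i, 1, 1) = 1/3 := by
  simp only [power, nb_z i 1, c1 I i 1 (by decide), c1 I i 2 (by decide), c1 I i 3 (by decide), Finset.filter_insert,
    Finset.filter_singleton, reduceCtorEq, if_true, if_false, c1I I i h]
  norm_num [Finset.card_insert_of_notMem, f01, f02, f03, f12, f13, f23]

theorem pz1n (i : ZMod n) (h : i ∉ I) :
    power (Hgraph n) (1/2) (CwaveConfig n I) (i, 1, 1) = 1/4 := by
  simp only [power, nb_z i 1, c1 I i 1 (by decide), c1 I i 2 (by decide), c1 I i 3 (by decide), Finset.filter_insert,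
    Finset.filter_singleton, reduceCtorEq, if_true, if_false, c1n I i h]
  norm_num [Finset.card_insert_of_notMem, f01, f02, f03, f12, f13, f23]

theorem neq (hn : 3 ≤ n) (i : ZMod n) :
    i + 1 ≠ i ∧ i - 1 ≠ i ∧ i + 1 ≠ i - 1 ∧ i ≠ i + 1 ∧ i ≠ i - 1 ∧ i - 1 ≠ i + 1 := by
  haveI : Fact (1 < n) := ⟨by omega⟩
  have h1 : i + 1 ≠ i := by simp
  have h2 : i - 1 ≠ i := by simp
  have h3 : i + 1 ≠ i - 1 := by
    intro h
    have h2 : ((2 : ℕ) : ZMod n) = 0 := by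
      push_cast; linear_combination h
    rw [ZMod.natCast_eq_zero_iff] at h2
    exact absurd (Nat.le_of_dvd (by norm_num) h2) (by omega)
  exact ⟨h1, h2, h3, h1.symm, h2.symm, h3.symm⟩

theorem pv0I (hn : 3 ≤ n) (i : ZMod n) (h : i ∈ I) :
    power (Hgraph n) (1/2) (CwaveConfig n I) (i, 0, 0) = 1/5 := by
  obtain ⟨h1, h2, h3, h4, h5, h6⟩ := neq hn i
  simp only [power, nb_v hn i 0, sub_zero, c0, Finset.filter_insert, Finset.filter_singleton, reduceCtorEq, if_true, if_false,
    c1I I i h]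
  norm_num [Finset.card_insert_of_notMem, f01, f02, f03, f12, f13, f23, h1, h2, h3, h4, h5, h6]

theorem pv0n (hn : 3 ≤ n) (i : ZMod n) (h : i ∉ I) :
    power (Hgraph n) (1/2) (CwaveConfig n I) (i, 0, 0) = 1/4 := by
  obtain ⟨h1, h2, h3, h4, h5, h6⟩ := neq hn i
  simp only [power, nb_v hn i 0, sub_zero, c0, Finset.filter_insert, Finset.filter_singleton, reduceCtorEq, if_true, if_false,
    c1n I i h]
  norm_num [Finset.card_insert_of_notMem, f01, f02, f03, f12, f13, f23, h1, h2, h3, h4, h5, h6]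

theorem pv1I (hn : 3 ≤ n) (hev : Even n) (hI : SameParity I) (i : ZMod n) (h : i ∈ I) :
    power (Hgraph n) (1/2) (CwaveConfig n I) (i, 1, 0) = 0 := by
  obtain ⟨h1, h2, h3, h4, h5, h6⟩ := neq hn i
  simp only [power, nb_v hn i 1, sub_self, c0, Finset.filter_insert, Finset.filter_singleton, reduceCtorEq, if_true, if_false,
    c1I I i h, c1n I _ (par hev I hI i h), c1n I _ (par' hev I hI i h), c1 I i 1 (by decide)]
  norm_num [Finset.card_insert_of_notMem, f01, f02, f03, f12, f13, f23, h1, h2, h3, h4, h5, h6]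

theorem pv1n0 (hn : 3 ≤ n) (i : ZMod n) (h : i ∉ I) (hm : i - 1 ∉ I) (hp : i + 1 ∉ I) :
    power (Hgraph n) (1/2) (CwaveConfig n I) (i, 1, 0) = 1/4 := by
  obtain ⟨h1, h2, h3, h4, h5, h6⟩ := neq hn i
  simp only [power, nb_v hn i 1, sub_self, c0, Finset.filter_insert, Finset.filter_singleton, reduceCtorEq, if_true, if_false,
    c1n I i h, c1n I _ hm, c1n I _ hp, c1 I i 1 (by decide)]
  norm_num [Finset.card_insert_of_notMem, f01, f02, f03, f12, f13, f23, h1, h2, h3, h4, h5, h6]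

theorem pv1n1 (hn : 3 ≤ n) (i : ZMod n) (h : i ∉ I) (hx : Xor' (i - 1 ∈ I) (i + 1 ∈ I)) :
    power (Hgraph n) (1/2) (CwaveConfig n I) (i, 1, 0) = 1/3 := by
  obtain ⟨h1, h2, h3, h4, h5, h6⟩ := neq hn i
  rcases hx with ⟨hm, hp⟩ | ⟨hp, hm⟩
  · simp only [power, nb_v hn i 1, sub_self, c0, Finset.filter_insert, Finset.filter_singleton, reduceCtorEq, if_true, if_false,
      c1n I i h, c1I I _ hm, c1n I _ hp, c1 I i 1 (by decide)]
    norm_num [Finset.card_insert_of_notMem, f01, f02, f03, f12, f13, f23, h1, h2, h3, h4, h5, h6]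
  · simp only [power, nb_v hn i 1, sub_self, c0, Finset.filter_insert, Finset.filter_singleton, reduceCtorEq, if_true, if_false,
      c1n I i h, c1n I _ hm, c1I I _ hp, c1 I i 1 (by decide)]
    norm_num [Finset.card_insert_of_notMem, f01, f02, f03, f12, f13, f23, h1, h2, h3, h4, h5, h6]

theorem pv1n2 (hn : 3 ≤ n) (i : ZMod n) (h : i ∉ I) (hm : i - 1 ∈ I) (hp : i + 1 ∈ I) :
    power (Hgraph n) (1/2) (CwaveConfig n I) (i, 1, 0) = 0 := by
  obtain ⟨h1, h2, h3, h4, h5, h6⟩ := neq hn i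
  simp only [power, nb_v hn i 1, sub_self, c0, Finset.filter_insert, Finset.filter_singleton, reduceCtorEq, if_true, if_false,
    c1n I i h, c1I I _ hm, c1I I _ hp, c1 I i 1 (by decide)]
  norm_num [Finset.card_insert_of_notMem, f01, f02, f03, f12, f13, f23, h1, h2, h3, h4, h5, h6]

theorem pv0le (hn : 3 ≤ n) (i : ZMod n) :
    power (Hgraph n) (1/2) (CwaveConfig n I) (i, 0, 0) ≤ 1/4 := by
  by_cases h : i ∈ I
  · rw [pv0I I hn i h]; norm_num
  · rw [pv0n I hn i h]

theorem pv1le (hn : 3 ≤ n) (hev : Even n) (hI : SameParity I) (i : ZMod n) :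
    power (Hgraph n) (1/2) (CwaveConfig n I) (i, 1, 0) ≤ 1/3 := by
  by_cases h : i ∈ I
  · rw [pv1I I hn hev hI i h]; norm_num
  by_cases hm : i - 1 ∈ I <;> by_cases hp : i + 1 ∈ I
  · rw [pv1n2 I hn i h hm hp]; norm_num
  · rw [pv1n1 I hn i h (Or.inl ⟨hm, hp⟩)]
  · rw [pv1n1 I hn i h (Or.inr ⟨hp, hm⟩)]
  · rw [pv1n0 I hn i h hm hp]; norm_num

/-- Triangle vertices keep their strategy. -/
theorem step_x (i : ZMod n) (j : Fin 2) (t : Fin 4) (ht : t = 2 ∨ t = 3) :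
    step (Hgraph n) (1/2) (CwaveConfig n I) (i, j, t) = CwaveConfig n I (i, j, 2) := by
  refine step_of _ _ _ _ _ (i, j, 2) ?_ rfl ?_
  · rw [nb_x i j t ht]; simp
  · rw [nb_x i j t ht]
    have h1 : CwaveConfig n I (i, j, t) = CwaveConfig n I (i, j, 2) := by
      rcases ht with rfl | rfl <;> simp [CwaveConfig]
    intro x hx
    refine ⟨?_, fun h => absurd h1 h⟩
    simp only [Finset.mem_insert, Finset.mem_singleton] at hx
    have hj : j = 0 ∨ j = 1 := by omega
    rcases hj with rfl | rfl
    · rcases hx with rfl | rfl | rfl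
      · rw [pz0, px0 I i 2 (by simp)]; norm_num
      · rfl
      · rw [px0 I i 2 (by simp), px0 I i 3 (by simp)]
    · rcases hx with rfl | rfl | rfl
      · rw [px1 I i 2 (by simp)]
        by_cases h : i ∈ I
        · rw [pz1I I i h]
        · rw [pz1n I i h]; norm_num
      · rfl
      · rw [px1 I i 2 (by simp), px1 I i 3 (by simp)]

theorem step_z (hn : 3 ≤ n) (hev : Even n) (hI : SameParity I) (i : ZMod n) (j : Fin 2) :
    step (Hgraph n) (1/2) (CwaveConfig n I) (i, j, 1) = CwaveConfig n I (i, j, 2) := by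
  refine step_of _ _ _ _ _ (i, j, 2) ?_ rfl ?_
  · rw [nb_z i j]; simp
  · rw [nb_z i j]
    have h1 : CwaveConfig n I (i, j, 1) = CwaveConfig n I (i, j, 2) := by
      simp [CwaveConfig]
    intro x hx
    refine ⟨?_, fun h => absurd h1 h⟩
    simp only [Finset.mem_insert, Finset.mem_singleton] at hx
    have hj : j = 0 ∨ j = 1 := by omega
    rcases hj with rfl | rfl
    · rcases hx with rfl | rfl | rfl | rfl
      · rw [px0 I i 2 (by simp)]; linarith [pv0le I hn i]
      · rw [pz0, px0 I i 2 (by simp)]; norm_num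
      · rfl
      · rw [px0 I i 2 (by simp), px0 I i 3 (by simp)]
    · rcases hx with rfl | rfl | rfl | rfl
      · rw [px1 I i 2 (by simp)]; exact pv1le I hn hev hI i
      · rw [px1 I i 2 (by simp)]
        by_cases h : i ∈ I
        · rw [pz1I I i h]
        · rw [pz1n I i h]; norm_num
      · rfl
      · rw [px1 I i 2 (by simp), px1 I i 3 (by simp)]

theorem step_v0 (hn : 3 ≤ n) (hev : Even n) (hI : SameParity I) (i : ZMod n)
    (hx : ¬ Xor' (i - 1 ∈ I) (i + 1 ∈ I)) :
    step (Hgraph n) (1/2) (CwaveConfig n I) (i, 0, 0) = .C := by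
  refine step_of _ _ _ _ _ (i, 0, 1) ?_ (c0 ..) ?_
  · rw [nb_v hn]; simp
  · rw [nb_v hn, pz0]
    intro x hm
    refine ⟨?_, fun h => absurd (c0 ..) h⟩
    simp only [Finset.mem_insert, Finset.mem_singleton, sub_zero] at hm
    rcases hm with rfl | rfl | rfl | rfl | rfl
    · exact pv0le I hn _
    · exact pv0le I hn _
    · exact pv0le I hn _
    · by_cases h : i ∈ I
      · rw [pv1I I hn hev hI i h]; norm_num
      by_cases hm : i - 1 ∈ I <;> by_cases hp : i + 1 ∈ I
      · rw [pv1n2 I hn i h hm hp]; norm_num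
      · exact absurd (Or.inl ⟨hm, hp⟩) hx
      · exact absurd (Or.inr ⟨hp, hm⟩) hx
      · rw [pv1n0 I hn i h hm hp]
    · rw [pz0]

theorem step_v0x (hn : 3 ≤ n) (hev : Even n) (hI : SameParity I) (i : ZMod n)
    (hx : Xor' (i - 1 ∈ I) (i + 1 ∈ I)) :
    step (Hgraph n) (1/2) (CwaveConfig n I) (i, 0, 0) = .D := by
  have hi : i ∉ I := by
    intro h
    rcases hx with ⟨hm, -⟩ | ⟨hp, -⟩
    · exact par' hev I hI i h hm
    · exact par hev I hI i h hp
  refine step_of _ _ _ _ _ (i, 1, 0) ?_ (c1n I i hi) ?_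
  · rw [nb_v hn]; simp
  · rw [nb_v hn, pv1n1 I hn i hi hx]
    intro x hm
    simp only [Finset.mem_insert, Finset.mem_singleton, sub_zero] at hm
    rcases hm with rfl | rfl | rfl | rfl | rfl
    · have := pv0le I hn i
      exact ⟨by linarith, fun _ _ => by linarith⟩
    · have := pv0le I hn (i + 1)
      exact ⟨by linarith, fun _ _ => by linarith⟩
    · have := pv0le I hn (i - 1)
      exact ⟨by linarith, fun _ _ => by linarith⟩
    · exact ⟨(pv1n1 I hn i hi hx).le, fun _ h => absurd (c1n I i hi) h⟩
    · rw [pz0]; norm_num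

theorem step_v1I (hn : 3 ≤ n) (hev : Even n) (hI : SameParity I) (i : ZMod n) (h : i ∈ I) :
    step (Hgraph n) (1/2) (CwaveConfig n I) (i, 1, 0) = .D := by
  have hcz := c1 I i 1 (by decide)
  refine step_of _ _ _ _ _ (i, 1, 1) ?_ hcz ?_
  · rw [nb_v hn]; simp
  · rw [nb_v hn, pz1I I i h]
    intro x hm
    simp only [Finset.mem_insert, Finset.mem_singleton, sub_self] at hm
    rcases hm with rfl | rfl | rfl | rfl | rfl
    · rw [pv1I I hn hev hI i h]; norm_num
    · exact ⟨pv1le I hn hev hI _, fun _ h' => absurd (c1n I _ (par hev I hI i h)) h'⟩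
    · exact ⟨pv1le I hn hev hI _, fun _ h' => absurd (c1n I _ (par' hev I hI i h)) h'⟩
    · have := pv0le I hn i
      exact ⟨by linarith, fun _ _ => by linarith⟩
    · exact ⟨(pz1I I i h).le, fun _ h' => absurd hcz h'⟩

/-- A defector with a maximal-power defector nearby stays a defector. -/
theorem step_v1n (hn : 3 ≤ n) (hev : Even n) (hI : SameParity I) (i : ZMod n) (h : i ∉ I) :
    step (Hgraph n) (1/2) (CwaveConfig n I) (i, 1, 0) = .D := by
  obtain ⟨u, hu, hmax⟩ := Finset.exists_max_image
    ((closedNbhd (Hgraph n) (i, 1, 0)).filter fun u => CwaveConfig n I u = .D)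
    (power (Hgraph n) (1/2) (CwaveConfig n I))
    ⟨(i, 1, 1), by
      rw [Finset.mem_filter, nb_v hn]; exact ⟨by simp, c1 I i 1 (by decide)⟩⟩
  rw [Finset.mem_filter] at hu
  have hz := hmax (i, 1, 1) (by
      rw [Finset.mem_filter, nb_v hn]; exact ⟨by simp, c1 I i 1 (by decide)⟩)
  rw [pz1n I i h] at hz
  refine step_of _ _ _ _ _ u hu.1 hu.2 ?_
  intro x hx
  refine ⟨?_, fun h' => absurd (c1n I i h) h'⟩
  by_cases hc : CwaveConfig n I x = .D
  · exact hmax x (Finset.mem_filter.2 ⟨hx, hc⟩)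
  have key : ∀ k, CwaveConfig n I (k, 1, 0) ≠ .D →
      power (Hgraph n) (1/2) (CwaveConfig n I) (k, 1, 0) = 0 := by
    intro k hk
    by_cases hkI : k ∈ I
    · exact pv1I I hn hev hI k hkI
    · exact absurd (c1n I k hkI) hk
  rw [nb_v hn] at hx
  simp only [Finset.mem_insert, Finset.mem_singleton, sub_self] at hx
  rcases hx with rfl | rfl | rfl | rfl | rfl
  · rw [key _ hc]; linarith
  · rw [key _ hc]; linarith
  · rw [key _ hc]; linarith
  · linarith [pv0le I hn i]
  · exact absurd (c1 I i 1 (by decide)) hc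

end

/-- Let `n ≥ 3` be even and let `C_k` be a `C`-wave configuration
of length `n` on `H_n` with interrupter columns `I` (all of the same parity). Then
the next configuration of the `1/2`-power index process is the `D`-wave
configuration whose interrupters are the vertices `v_{i,1}` such that exactly one of
`v_{i-1,2}` and `v_{i+1,2}` is an interrupter of `C_k`. -/
theorem statement10 (n : ℕ) [NeZero n] (hn : 3 ≤ n) (hev : Even n)
    (I : Set (ZMod n)) (hI : SameParity I) :
    step (Hgraph n) (1 / 2) (CwaveConfig n I) =
      DwaveConfig n {i : ZMod n | Xor' ((i - 1) ∈ I) ((i + 1) ∈ I)} := by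
  funext ⟨i, j, t⟩
  have hj : j = 0 ∨ j = 1 := by omega
  have ht : t = 0 ∨ t = 1 ∨ t = 2 ∨ t = 3 := by omega
  rcases ht with rfl | rfl | ht
  · rcases hj with rfl | rfl
    · by_cases hx : Xor' (i - 1 ∈ I) (i + 1 ∈ I)
      · rw [step_v0x I hn hev hI i hx]
        simp [DwaveConfig, hx]
      · rw [step_v0 I hn hev hI i hx]
        simp [DwaveConfig, hx]
    · by_cases h : i ∈ I
      · rw [step_v1I I hn hev hI i h]
        simp [DwaveConfig]
      · rw [step_v1n I hn hev hI i h]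
        simp [DwaveConfig]
  · rw [step_z I hn hev hI]
    rcases hj with rfl | rfl <;> simp [DwaveConfig, CwaveConfig]
  · rw [step_x I i j t ht]
    rcases hj with rfl | rfl <;> rcases ht with rfl | rfl <;> simp [DwaveConfig, CwaveConfig]
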